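/- Let g := c₀·1 + c₁·e₂e₃ + c₂·e₁e₃ + c₃·e₁e₂ ∈ Cl₀,₃,₁ with c₀² + c₁² + c₂² + c₃² = 1, and let t ∈ ℝ⁴ have fourth coordinate zero. Define the motion of a vector x ∈ ℝ⁴ with fourth coordinate zero by m(x) := g·ι(x)·star(g) + ι(t). Then this motion is rigid: for all such x, y, (m(x) − m(y))·star(m(x) − m(y)) = (ι(x) − ι(y))·star(ι(x) − ι(y)), i.e., Euclidean distances are preserved. -/

import Mathlib

noncomputable section

open CliffordAlgebra

/-- The degenerate quadratic form on `ℝ⁴`: `Q₄ x = -(x₀² + x₁² + x₂²)`,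
the fourth coordinate contributing `0`. -/
def Q4 : QuadraticForm ℝ (Fin 4 → ℝ) :=
  QuadraticMap.weightedSumSquares ℝ (fun i : Fin 4 => if (i : ℕ) < 3 then (-1 : ℝ) else 0)

/-- The generators `eᵢ = ι(bᵢ)` of `Cl₀,₃,₁`. -/
def e (i : Fin 4) : CliffordAlgebra Q4 := ι Q4 (Pi.single i 1)

/-- Clifford conjugation: grade involution followed by reversion. -/
def cstar (x : CliffordAlgebra Q4) : CliffordAlgebra Q4 :=
  reverse (involute x)

theorem e_mul_e_swap {i j : Fin 4} (h : i ≠ j) : e j * e i = -(e i * e j) := by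
  refine ι_mul_ι_comm_of_isOrtho ?_
  rw [QuadraticMap.isOrtho_def]
  fin_cases i <;> fin_cases j <;>
    simp [Q4, QuadraticMap.weightedSumSquares_apply, Fin.sum_univ_four] at h ⊢

theorem e_mul_self {i : Fin 4} (h : (i : ℕ) < 3) : e i * e i = -1 := by
  have hQ : Q4 (Pi.single i 1) = -1 := by
    simp [Q4, QuadraticMap.weightedSumSquares_apply, Pi.single_apply, h]
  rw [e, ι_sq_scalar, hQ, map_neg, map_one]

/-- The square of a linear combination of three anticommuting square roots of `-1`. -/
theorem sq_add_smul_of_anticomm {A : Type*} [Ring A] [Algebra ℝ A] {u v w : A}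
    (hu : u * u = -1) (hv : v * v = -1) (hw : w * w = -1)
    (huv : v * u = -(u * v)) (huw : w * u = -(u * w)) (hvw : w * v = -(v * w)) (a b c : ℝ) :
    (a • u + b • v + c • w) * (a • u + b • v + c • w) = -((a ^ 2 + b ^ 2 + c ^ 2) • (1 : A)) := by
  simp only [add_mul, mul_add, smul_mul_smul_comm, hu, hv, hw, huv, huw, hvw]
  module

theorem bivector_mul_self {i j : Fin 4} (hi : (i : ℕ) < 3) (hj : (j : ℕ) < 3) (h : i ≠ j) :
    e i * e j * (e i * e j) = -1 := by
  rw [mul_assoc, ← mul_assoc (e j), e_mul_e_swap h, neg_mul, mul_assoc, e_mul_self hj, mul_neg,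
    mul_neg, mul_one, mul_neg, neg_neg, e_mul_self hi]

theorem bivector_sum_mul_self (c₁ c₂ c₃ : ℝ) :
    (c₁ • (e 1 * e 2) + c₂ • (e 0 * e 2) + c₃ • (e 0 * e 1)) *
        (c₁ • (e 1 * e 2) + c₂ • (e 0 * e 2) + c₃ • (e 0 * e 1))
      = -((c₁ ^ 2 + c₂ ^ 2 + c₃ ^ 2) • (1 : CliffordAlgebra Q4)) := by
  have h01 : e 1 * e 0 = -(e 0 * e 1) := e_mul_e_swap (by decide)
  have h02 : e 2 * e 0 = -(e 0 * e 2) := e_mul_e_swap (by decide)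
  have h12 : e 2 * e 1 = -(e 1 * e 2) := e_mul_e_swap (by decide)
  have h01' (z) : e 1 * (e 0 * z) = -(e 0 * (e 1 * z)) := by
    rw [← mul_assoc, h01, neg_mul, mul_assoc]
  have h02' (z) : e 2 * (e 0 * z) = -(e 0 * (e 2 * z)) := by
    rw [← mul_assoc, h02, neg_mul, mul_assoc]
  have h12' (z) : e 2 * (e 1 * z) = -(e 1 * (e 2 * z)) := by
    rw [← mul_assoc, h12, neg_mul, mul_assoc]
  refine sq_add_smul_of_anticomm (bivector_mul_self (by decide) (by decide) (by decide))
    (bivector_mul_self (by decide) (by decide) (by decide))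
    (bivector_mul_self (by decide) (by decide) (by decide)) ?_ ?_ ?_ c₁ c₂ c₃ <;>
  simp only [mul_assoc, h12, h01', h02', h12', mul_neg, neg_neg]

theorem star_bivector {i j : Fin 4} (h : i ≠ j) : star (e i * e j) = -(e i * e j) := by
  rw [star_mul, e, e, star_ι, star_ι, neg_mul_neg]
  exact e_mul_e_swap h

/-- A sandwich `v ↦ g * v * star g` by a unitary `g` preserves `v * star v` on vectors. -/
theorem sandwich_mul_star_sandwich {R M : Type*} [CommRing R] [AddCommGroup M] [Module R M]
    {Q : QuadraticForm R M} {g : CliffordAlgebra Q} (hg : g ∈ unitary (CliffordAlgebra Q))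
    (v : M) :
    g * ι Q v * star g * star (g * ι Q v * star g) = ι Q v * star (ι Q v) := by
  have hv : ι Q v * star (ι Q v) = algebraMap R _ (-Q v) := by
    rw [star_ι, mul_neg, ι_sq_scalar, map_neg]
  calc g * ι Q v * star g * star (g * ι Q v * star g)
      = g * ι Q v * (star g * g) * star (ι Q v) * star g := by
        simp only [star_mul, star_star, mul_assoc]
    _ = g * (ι Q v * star (ι Q v)) * star g := by
        rw [Unitary.star_mul_self_of_mem hg, mul_one, mul_assoc g]
    _ = ι Q v * star (ι Q v) := by
        rw [hv, ← Algebra.commutes, mul_assoc, Unitary.mul_star_self_of_mem hg, mul_one]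

/-- The motion `x ↦ g·ι(x)·star g + ι(t)` determined by a unit quaternion `g` and a
translation vector `t` is rigid: Euclidean distances are preserved. -/
theorem stmt19 (c₀ c₁ c₂ c₃ : ℝ) (hc : c₀ ^ 2 + c₁ ^ 2 + c₂ ^ 2 + c₃ ^ 2 = 1)
    (t : Fin 4 → ℝ) (ht : t 3 = 0)
    (g : CliffordAlgebra Q4)
    (hg : g = c₀ • (1 : CliffordAlgebra Q4) + c₁ • (e 1 * e 2) + c₂ • (e 0 * e 2)
        + c₃ • (e 0 * e 1))
    (x y : Fin 4 → ℝ) (hx : x 3 = 0) (hy : y 3 = 0) :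
    ((g * ι Q4 x * cstar g + ι Q4 t) - (g * ι Q4 y * cstar g + ι Q4 t)) *
        cstar ((g * ι Q4 x * cstar g + ι Q4 t) - (g * ι Q4 y * cstar g + ι Q4 t))
      = (ι Q4 x - ι Q4 y) * cstar (ι Q4 x - ι Q4 y) := by
  have hstar : ∀ z : CliffordAlgebra Q4, cstar z = star z := fun _ => rfl
  set w := c₁ • (e 1 * e 2) + c₂ • (e 0 * e 2) + c₃ • (e 0 * e 1) with hw
  have hgw : g = c₀ • 1 + w := by rw [hg, hw]; abel
  have hsw : star w = -w := by
    simp only [hw, star_add, CliffordAlgebra.star_smul,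
      star_bivector (show (1 : Fin 4) ≠ 2 by decide),
      star_bivector (show (0 : Fin 4) ≠ 2 by decide),
      star_bivector (show (0 : Fin 4) ≠ 1 by decide)]
    module
  have hsg : star g = c₀ • 1 - w := by
    rw [hgw, star_add, CliffordAlgebra.star_smul, star_one, hsw, sub_eq_add_neg]
  have hww : w * w = -((c₁ ^ 2 + c₂ ^ 2 + c₃ ^ 2) • (1 : CliffordAlgebra Q4)) :=
    bivector_sum_mul_self c₁ c₂ c₃
  have hone : (c₀ ^ 2 + (c₁ ^ 2 + c₂ ^ 2 + c₃ ^ 2)) • (1 : CliffordAlgebra Q4) = 1 := by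
    rw [← add_assoc, ← add_assoc, hc, one_smul]
  have hmem : g ∈ unitary (CliffordAlgebra Q4) := by
    rw [Unitary.mem_iff, hsg, hgw]
    constructor <;>
    · refine Eq.trans ?_ hone
      simp only [sub_mul, mul_sub, add_mul, mul_add, smul_mul_assoc, mul_smul_comm, one_mul,
        mul_one, hww]
      module
  rw [add_sub_add_right_eq_sub, ← sub_mul, ← mul_sub, ← map_sub, hstar, hstar, hstar]
  exact sandwich_mul_star_sandwich hmem (x - y)

end
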